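/- Let O be a finite set of items and let v_1, v_2 be nonnegative additive valuations on O with v_1(O) = v_2(O) = 1, and define chore costs c_1 = v_1 and c_2 = v_2. If an allocation (A_1, A_2) maximizes the social welfare v_1(A_1) + v_2(A_2) among all goods-EF1 allocations of O, then the swapped allocation (A_2, A_1) is chores-EF1 and minimizes the social cost c_1(·) + c_2(·) among all chores-EF1 allocations of O. -/

import Mathlib

open Finset

/-- Goods EF1 for two agents. -/
def GoodsEF1 {ι : Type*} [DecidableEq ι] (v : Fin 2 → ι → ℝ)
    (A : Fin 2 → Finset ι) : Prop :=
  ∀ i j : Fin 2, ∃ S ⊆ A j, S.card ≤ 1 ∧ ∑ o ∈ A j \ S, v i o ≤ ∑ o ∈ A i, v i o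

/-- Chores EF1 for two agents. -/
def ChoresEF1 {ι : Type*} [DecidableEq ι] (c : Fin 2 → ι → ℝ)
    (A : Fin 2 → Finset ι) : Prop :=
  ∀ i j : Fin 2, ∃ S ⊆ A i, S.card ≤ 1 ∧ ∑ o ∈ A i \ S, c i o ≤ ∑ o ∈ A j, c i o

/-- Social welfare of a two-agent allocation. -/
def SW {ι : Type*} (v : Fin 2 → ι → ℝ) (A : Fin 2 → Finset ι) : ℝ :=
  ∑ i, ∑ o ∈ A i, v i o

/-- Social cost of a two-agent allocation. -/
def SC {ι : Type*} (c : Fin 2 → ι → ℝ) (A : Fin 2 → Finset ι) : ℝ :=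
  ∑ i, ∑ o ∈ A i, c i o

theorem choresEF1_swap_iff_goodsEF1 {ι : Type*} [DecidableEq ι] (v : Fin 2 → ι → ℝ)
    (A : Fin 2 → Finset ι) : ChoresEF1 v ![A 1, A 0] ↔ GoodsEF1 v A := by
  have self (i : Fin 2) (T : Finset ι) :
      ∃ S ⊆ T, S.card ≤ 1 ∧ ∑ o ∈ T \ S, v i o ≤ ∑ o ∈ T, v i o :=
    ⟨∅, by simp⟩
  simp [ChoresEF1, GoodsEF1, Fin.forall_fin_two, self]

theorem SC_swap_add_SW {ι : Type*} [Fintype ι] [DecidableEq ι] (v : Fin 2 → ι → ℝ)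
    (A : Fin 2 → Finset ι) (hdisj : Disjoint (A 0) (A 1))
    (hcover : A 0 ∪ A 1 = Finset.univ) :
    SC v ![A 1, A 0] + SW v A = ∑ i, ∑ o, v i o := by
  simp only [SC, SW, Fin.sum_univ_two, ← hcover, sum_union hdisj, Matrix.cons_val_zero,
    Matrix.cons_val_one]
  ring

/-- If `(A₁, A₂)` maximizes social welfare among goods-EF1 allocations, then the swapped
allocation `(A₂, A₁)` is chores-EF1 and minimizes social cost among chores-EF1 allocations. -/
theorem swap_of_optimal_goods_ef1 (ι : Type*) [Fintype ι] [DecidableEq ι]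
    (v : Fin 2 → ι → ℝ) (hnn : ∀ i o, 0 ≤ v i o) (hnorm : ∀ i, ∑ o, v i o = 1)
    (A : Fin 2 → Finset ι) (hdisj : Disjoint (A 0) (A 1))
    (hcover : A 0 ∪ A 1 = Finset.univ) (hEF1 : GoodsEF1 v A)
    (hmax : ∀ B : Fin 2 → Finset ι, Disjoint (B 0) (B 1) → B 0 ∪ B 1 = Finset.univ →
      GoodsEF1 v B → SW v B ≤ SW v A) :
    ChoresEF1 v ![A 1, A 0] ∧
    ∀ B : Fin 2 → Finset ι, Disjoint (B 0) (B 1) → B 0 ∪ B 1 = Finset.univ →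
      ChoresEF1 v B → SC v ![A 1, A 0] ≤ SC v B := by
  refine ⟨(choresEF1_swap_iff_goodsEF1 v A).2 hEF1, fun B hB hBcover hBEF1 => ?_⟩
  have hBswap : ![![B 1, B 0] 1, ![B 1, B 0] 0] = B := by
    ext i : 1
    fin_cases i <;> rfl
  have hle := hmax ![B 1, B 0] hB.symm ((union_comm _ _).trans hBcover)
    ((choresEF1_swap_iff_goodsEF1 v _).1 (by rwa [hBswap]))
  have hsumA := SC_swap_add_SW v A hdisj hcover
  have hsumB := SC_swap_add_SW v ![B 1, B 0] hB.symm ((union_comm _ _).trans hBcover)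
  rw [hBswap] at hsumB
  linarith
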